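/- arXiv:2402.10661 — 2 statements merged into one kernel-verified Lean document; each statement's English description precedes it below -/
import Mathlib

section
/- Let n ≥ 2 be an integer, let r ≥ 1 and c ∈ ℝ with r² ≤ 2c. Then the cyclic integral ∫_{(0,∞)^n} Ai(x_1+x_2+2c)·Ai(x_2+x_3+2c)···Ai(x_{n−1}+x_n+2c)·Ai(x_n+x_1+2c) dx_1⋯dx_n is absolutely convergent and its absolute value is at most β^n. -/
open MeasureTheory

/-- The Airy function, defined by an absolutely convergent contour integral
over the vertical line `Re w = 1`. -/
noncomputable def Ai (x : ℝ) : ℝ :=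
  (1 / (2 * Real.pi)) *
    ∫ t : ℝ, (Complex.exp ((1 + (t : ℂ) * Complex.I) ^ 3 / 3
      - (1 + (t : ℂ) * Complex.I) * (x : ℂ))).re

/-- The constant `β = max{2 e^{r³/3 - 2rc}, e^{(r-1/7)³/3 - 2(r-1/7)c}}`. -/
noncomputable def beta (r c : ℝ) : ℝ :=
  max (2 * Real.exp (r ^ 3 / 3 - 2 * r * c))
    (Real.exp ((r - 1 / 7) ^ 3 / 3 - 2 * (r - 1 / 7) * c))

open Filter Topology

/-- The integrand `e^{w³/3 - w x}` of the Airy contour integral. -/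
noncomputable def airyIntegrand (x : ℝ) (w : ℂ) : ℂ :=
  Complex.exp (w ^ 3 / 3 - w * (x : ℂ))

lemma differentiable_airyIntegrand (x : ℝ) : Differentiable ℂ (airyIntegrand x) := by
  unfold airyIntegrand
  fun_prop

lemma norm_airyIntegrand (x a t : ℝ) :
    ‖airyIntegrand x ((a : ℂ) + (t : ℂ) * Complex.I)‖ =
      Real.exp (a ^ 3 / 3 - a * x) * Real.exp (-a * t ^ 2) := by
  have h : ((a : ℂ) + (t : ℂ) * Complex.I) ^ 3 / 3 - ((a : ℂ) + (t : ℂ) * Complex.I) * (x : ℂ)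
      = ((a ^ 3 / 3 - a * x - a * t ^ 2 : ℝ) : ℂ)
        + ((a ^ 2 * t - t ^ 3 / 3 - t * x : ℝ) : ℂ) * Complex.I := by
    have hI : Complex.I ^ 3 = -Complex.I := Complex.I_pow_three
    push_cast
    linear_combination (a : ℂ) * (t : ℂ) ^ 2 * Complex.I_sq + (t : ℂ) ^ 3 / 3 * hI
  rw [airyIntegrand, h, Complex.norm_exp, ← Real.exp_add]
  congr 1
  rw [Complex.add_re, Complex.re_ofReal_mul, Complex.ofReal_re, Complex.I_re]
  ring

lemma integrable_airyIntegrand (x : ℝ) {a : ℝ} (ha : 0 < a) :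
    Integrable fun t : ℝ => airyIntegrand x ((a : ℂ) + (t : ℂ) * Complex.I) := by
  have hc : Continuous fun t : ℝ => airyIntegrand x ((a : ℂ) + (t : ℂ) * Complex.I) :=
    (differentiable_airyIntegrand x).continuous.comp (by fun_prop)
  refine ((integrable_exp_neg_mul_sq ha).const_mul (Real.exp (a ^ 3 / 3 - a * x))).mono'
    hc.aestronglyMeasurable (ae_of_all _ fun t => (norm_airyIntegrand x a t).le)

/-- The integral of the Airy integrand along a horizontal segment tends to zero as the segment
recedes to infinity. -/
lemma tendsto_horizontal_airyIntegrand (x : ℝ) {r : ℝ} (hr : 1 ≤ r) {u : ℝ → ℝ}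
    (hu : ∀ T, u T ^ 2 = T ^ 2) :
    Tendsto (fun T : ℝ => ∫ s in (1 : ℝ)..r, airyIntegrand x ((s : ℂ) + (u T : ℂ) * Complex.I))
      atTop (𝓝 0) := by
  have hlim : Tendsto (fun T : ℝ => Real.exp (r ^ 3 / 3 + r * |x|) * Real.exp (-T ^ 2) * |r - 1|)
      atTop (𝓝 0) := by
    have h1 : Tendsto (fun T : ℝ => Real.exp (-T ^ 2)) atTop (𝓝 0) :=
      Real.tendsto_exp_neg_atTop_nhds_zero.comp (tendsto_pow_atTop two_ne_zero)
    simpa using (h1.const_mul (Real.exp (r ^ 3 / 3 + r * |x|))).mul_const |r - 1|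
  refine squeeze_zero_norm (fun T => ?_) hlim
  refine intervalIntegral.norm_integral_le_of_norm_le_const fun s hs => ?_
  rw [Set.uIoc_of_le hr] at hs
  rw [norm_airyIntegrand, hu]
  have h0 : 0 ≤ s := by linarith [hs.1]
  have hx : -(s * x) ≤ r * |x| := by
    calc -(s * x) = s * (-x) := by ring
      _ ≤ s * |x| := mul_le_mul_of_nonneg_left (neg_le_abs x) h0
      _ ≤ r * |x| := mul_le_mul_of_nonneg_right hs.2 (abs_nonneg x)
  have h3 : s ^ 3 ≤ r ^ 3 := pow_le_pow_left₀ h0 hs.2 3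
  gcongr
  · linarith
  · nlinarith [sq_nonneg T, hs.1]

/-- The Airy contour may be moved from `Re w = 1` to `Re w = r`. -/
lemma integral_airyIntegrand_eq (x : ℝ) {r : ℝ} (hr : 1 ≤ r) :
    ∫ t : ℝ, airyIntegrand x ((1 : ℝ) + (t : ℂ) * Complex.I) =
      ∫ t : ℝ, airyIntegrand x ((r : ℂ) + (t : ℂ) * Complex.I) := by
  have hline {a : ℝ} (ha : 0 < a) :
      Tendsto (fun T : ℝ => ∫ t in (-T)..T, airyIntegrand x ((a : ℂ) + (t : ℂ) * Complex.I))
        atTop (𝓝 (∫ t : ℝ, airyIntegrand x ((a : ℂ) + (t : ℂ) * Complex.I))) :=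
    intervalIntegral_tendsto_integral (integrable_airyIntegrand x ha)
      tendsto_neg_atTop_atBot tendsto_id
  have hrect (T : ℝ) :
      (∫ s in (1 : ℝ)..r, airyIntegrand x ((s : ℂ) + ((-T : ℝ) : ℂ) * Complex.I))
        - (∫ s in (1 : ℝ)..r, airyIntegrand x ((s : ℂ) + (T : ℂ) * Complex.I))
        + Complex.I * (∫ t in (-T)..T, airyIntegrand x ((r : ℂ) + (t : ℂ) * Complex.I))
        - Complex.I * (∫ t in (-T)..T, airyIntegrand x ((1 : ℝ) + (t : ℂ) * Complex.I)) = 0 := by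
    simpa using Complex.integral_boundary_rect_eq_zero_of_differentiableOn (airyIntegrand x)
      (⟨1, -T⟩ : ℂ) (⟨r, T⟩ : ℂ) (differentiable_airyIntegrand x).differentiableOn
  have hlim := (((tendsto_horizontal_airyIntegrand x hr (u := fun T => -T) (by simp)).sub
    (tendsto_horizontal_airyIntegrand x hr (u := fun T => T) (by simp))).add
    ((hline (zero_lt_one.trans_le hr)).const_mul Complex.I)).sub
    ((hline zero_lt_one).const_mul Complex.I)
  have h0 := tendsto_nhds_unique (hlim.congr hrect) tendsto_const_nhds
  have h1 : Complex.I * ((∫ t : ℝ, airyIntegrand x ((r : ℂ) + (t : ℂ) * Complex.I))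
      - ∫ t : ℝ, airyIntegrand x ((1 : ℝ) + (t : ℂ) * Complex.I)) = 0 := by
    linear_combination h0
  exact (sub_eq_zero.mp ((mul_eq_zero.mp h1).resolve_left Complex.I_ne_zero)).symm

lemma abs_Ai_le (x : ℝ) {r : ℝ} (hr : 1 ≤ r) :
    |Ai x| ≤ Real.exp (r ^ 3 / 3 - r * x) := by
  have hr0 : 0 < r := zero_lt_one.trans_le hr
  have hAi : Ai x = 1 / (2 * Real.pi) *
      (∫ t : ℝ, airyIntegrand x ((1 : ℝ) + (t : ℂ) * Complex.I)).re := by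
    have h := integral_re (integrable_airyIntegrand x zero_lt_one)
    simp only [RCLike.re_to_complex] at h
    rw [← h]
    simp [Ai, airyIntegrand]
  have hnorm : ‖∫ t : ℝ, airyIntegrand x ((r : ℂ) + (t : ℂ) * Complex.I)‖
      ≤ Real.exp (r ^ 3 / 3 - r * x) * √(Real.pi / r) := by
    refine (norm_integral_le_integral_norm _).trans_eq ?_
    simp_rw [norm_airyIntegrand]
    rw [integral_const_mul, integral_gaussian]
  have hsqrt : √(Real.pi / r) ≤ 2 * Real.pi := by
    refine Real.sqrt_le_iff.mpr ⟨by positivity, ?_⟩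
    have := div_le_self Real.pi_pos.le hr
    nlinarith [Real.pi_gt_three]
  rw [hAi, integral_airyIntegrand_eq x hr, abs_mul, abs_of_nonneg (by positivity)]
  calc _ ≤ 1 / (2 * Real.pi) * (Real.exp (r ^ 3 / 3 - r * x) * (2 * Real.pi)) := by
        gcongr
        exact (Complex.abs_re_le_norm _).trans (hnorm.trans (by gcongr))
    _ = Real.exp (r ^ 3 / 3 - r * x) := by
        field_simp

lemma measurable_Ai : Measurable Ai := by
  have h : StronglyMeasurable fun p : ℝ × ℝ =>
      (Complex.exp ((1 + (p.2 : ℂ) * Complex.I) ^ 3 / 3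
        - (1 + (p.2 : ℂ) * Complex.I) * (p.1 : ℂ))).re :=
    Continuous.stronglyMeasurable (by fun_prop)
  exact (h.integral_prod_right'.measurable).const_mul _

/-- The trace of `(P₀ B_{0,c})^n`: the cyclic integral over `(0,∞)^n` of
`∏ Ai(x_i + x_{i+1} + 2c)` is absolutely convergent and bounded by `β^n`. -/
theorem trace_P0B_pow (n : ℕ) [NeZero n] (hn : 2 ≤ n) (r c : ℝ)
    (hr : 1 ≤ r) (hrc : r ^ 2 ≤ 2 * c) :
    IntegrableOn (fun x : Fin n → ℝ => ∏ i : Fin n, Ai (x i + x (i + 1) + 2 * c))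
      (Set.univ.pi fun _ => Set.Ioi (0 : ℝ)) ∧
    |∫ x in Set.univ.pi fun _ : Fin n => Set.Ioi (0 : ℝ),
        ∏ i : Fin n, Ai (x i + x (i + 1) + 2 * c)| ≤ beta r c ^ n := by
  have hr0 : 0 < r := zero_lt_one.trans_le hr
  set g : ℝ → ℝ := fun y => Real.exp (r ^ 3 / 3 - 2 * r * c) * Real.exp (-(2 * r) * y) with hg
  have hbound (x : Fin n → ℝ) :
      ‖∏ i : Fin n, Ai (x i + x (i + 1) + 2 * c)‖ ≤ ∏ i : Fin n, g (x i) := by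
    have hshift : ∏ i : Fin n, Real.exp (-r * x (i + 1)) = ∏ i : Fin n, Real.exp (-r * x i) :=
      Equiv.prod_comp (Equiv.addRight (1 : Fin n)) fun i => Real.exp (-r * x i)
    calc ‖∏ i : Fin n, Ai (x i + x (i + 1) + 2 * c)‖
        = ∏ i : Fin n, |Ai (x i + x (i + 1) + 2 * c)| := by
          rw [Real.norm_eq_abs, Finset.abs_prod]
      _ ≤ ∏ i : Fin n, Real.exp (r ^ 3 / 3 - r * (x i + x (i + 1) + 2 * c)) :=
          Finset.prod_le_prod (fun _ _ => abs_nonneg _) fun _ _ => abs_Ai_le _ hr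
      _ = ∏ i : Fin n, (Real.exp (r ^ 3 / 3 - 2 * r * c) * Real.exp (-r * x i)
            * Real.exp (-r * x (i + 1))) := by
          refine Finset.prod_congr rfl fun i _ => ?_
          rw [← Real.exp_add, ← Real.exp_add]
          ring_nf
      _ = ∏ i : Fin n, g (x i) := by
          rw [Finset.prod_mul_distrib, hshift, ← Finset.prod_mul_distrib]
          refine Finset.prod_congr rfl fun i _ => ?_
          simp only [hg]
          rw [mul_assoc, ← Real.exp_add]
          ring_nf
  have hgi : IntegrableOn g (Set.Ioi 0) :=
    (integrableOn_exp_mul_Ioi (by linarith) 0).const_mul _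
  have hgv : ∫ y in Set.Ioi (0 : ℝ), g y ≤ beta r c := by
    rw [hg, integral_const_mul, integral_exp_mul_Ioi (by linarith)]
    refine le_trans ?_ (le_max_left _ _)
    rw [mul_comm 2 (Real.exp _)]
    gcongr
    rw [mul_zero, Real.exp_zero, neg_div_neg_eq, div_le_iff₀ (by positivity)]
    linarith
  have hrestrict : (volume : Measure (Fin n → ℝ)).restrict (Set.univ.pi fun _ => Set.Ioi 0) =
      Measure.pi fun _ => (volume : Measure ℝ).restrict (Set.Ioi 0) := by
    rw [volume_pi, Measure.restrict_pi_pi]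
  have hgint : Integrable (fun x : Fin n → ℝ => ∏ i, g (x i))
      (Measure.pi fun _ => (volume : Measure ℝ).restrict (Set.Ioi 0)) :=
    Integrable.fintype_prod fun _ => hgi
  have hmeas : Measurable fun x : Fin n → ℝ => ∏ i : Fin n, Ai (x i + x (i + 1) + 2 * c) :=
    Finset.measurable_fun_prod _ fun i _ => measurable_Ai.comp (by fun_prop)
  rw [IntegrableOn, hrestrict]
  refine ⟨hgint.mono' hmeas.aestronglyMeasurable (ae_of_all _ hbound), ?_⟩
  calc _ ≤ ∫ x, ∏ i : Fin n, g (x i) ∂(Measure.pi fun _ => volume.restrict (Set.Ioi 0)) :=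
        norm_integral_le_of_norm_le hgint (ae_of_all _ hbound)
    _ = (∫ y in Set.Ioi (0 : ℝ), g y) ^ n := by
        rw [integral_fintype_prod_eq_prod]
        simp
    _ ≤ beta r c ^ n :=
        pow_le_pow_left₀ (integral_nonneg fun _ => by positivity) hgv n
end

section
/- For every integer n ≥ 1, every c ∈ ℝ and all x, y ∈ ℝ, ∫_{ℝ^{n−1}} Ai(x − z_1 + 2c)·Ai(z_1 − z_2 + 2c)···Ai(z_{n−2} − z_{n−1} + 2c)·Ai(z_{n−1} + y + 2c) dz_1⋯dz_{n−1} = n^{−1/3}·Ai(n^{−1/3}·(x + y + 2nc)), the integral being absolutely convergent (for n = 1 the identity reads Ai(x+y+2c) = Ai(x+y+2c)). -/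
open MeasureTheory

open Complex Filter Topology FourierTransform

/-- The integrand `w ↦ exp (k w³ / 3 - w s)` of the dilated Airy contour integral. -/
noncomputable def airyKernel (k s : ℝ) (w : ℂ) : ℂ :=
  exp (k * w ^ 3 / 3 - w * s)

/-- The dilated Airy function `s ↦ k ^ (-1/3) Ai (k ^ (-1/3) s)`, as an integral over
the line `Re w = 1`. -/
noncomputable def dilatedAiry (k s : ℝ) : ℂ :=
  (1 / (2 * Real.pi)) * ∫ t : ℝ, airyKernel k s ((1 : ℝ) + t * I)

theorem continuous_airyKernel (k s : ℝ) : Continuous (airyKernel k s) := by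
  unfold airyKernel; fun_prop

theorem norm_airyKernel (k s r t : ℝ) :
    ‖airyKernel k s (r + t * I)‖ =
      Real.exp (k * r ^ 3 / 3 - r * s) * Real.exp (-(k * r) * t ^ 2) := by
  rw [airyKernel, norm_exp, ← Real.exp_add]
  congr 1
  have : (k : ℂ) * (r + t * I) ^ 3 / 3 - (r + t * I) * s =
      ((k * r ^ 3 / 3 - r * s + -(k * r) * t ^ 2 : ℝ) : ℂ) +
        ((k * r ^ 2 * t - k * t ^ 3 / 3 - t * s : ℝ) : ℂ) * I := by
    have hI : I ^ 3 = -I := I_pow_three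
    push_cast
    linear_combination (k * r * t ^ 2 : ℂ) * I_sq + (k * t ^ 3 / 3 : ℂ) * hI
  rw [this, add_re, re_ofReal_mul, I_re, mul_zero, add_zero, ofReal_re]

theorem integrable_airyKernel {k r : ℝ} (hk : 0 < k) (hr : 0 < r) (s : ℝ) :
    Integrable (fun t : ℝ => airyKernel k s (r + t * I)) := by
  refine ((integrable_exp_neg_mul_sq (mul_pos hk hr)).const_mul
    (Real.exp (k * r ^ 3 / 3 - r * s))).mono' ?_ (.of_forall fun t => ?_)
  · exact ((continuous_airyKernel k s).comp (by fun_prop)).aestronglyMeasurable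
  · rw [norm_airyKernel]

theorem tendsto_integral_airyKernel_horizontal {k a b : ℝ} (hk : 0 < k) (ha : 0 < a)
    (hab : a ≤ b) (s ε : ℝ) (hε : ε ^ 2 = 1) :
    Tendsto (fun T : ℝ => ∫ x in a..b, airyKernel k s (x + (ε * T : ℝ) * I)) atTop (𝓝 0) := by
  have hlim : Tendsto (fun T : ℝ => Real.exp (k * b ^ 3 / 3 + b * |s|) *
      Real.exp (-(k * a) * T ^ 2) * |b - a|) atTop (𝓝 0) := by
    have h : Tendsto (fun T : ℝ => Real.exp (-(k * a) * T ^ 2)) atTop (𝓝 0) :=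
      Real.tendsto_exp_atBot.comp
        ((tendsto_pow_atTop two_ne_zero).const_mul_atTop_of_neg (by nlinarith))
    simpa using (h.const_mul (Real.exp (k * b ^ 3 / 3 + b * |s|))).mul_const |b - a|
  refine squeeze_zero_norm (fun T => ?_) hlim
  refine intervalIntegral.norm_integral_le_of_norm_le_const fun x hx => ?_
  rw [Set.uIoc_of_le hab] at hx
  have hx0 : 0 < x := ha.trans hx.1
  rw [norm_airyKernel, mul_pow, hε, one_mul]
  have h1 : x ^ 3 ≤ b ^ 3 := pow_le_pow_left₀ hx0.le hx.2 3
  have h2 : -(x * s) ≤ b * |s| :=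
    calc -(x * s) ≤ x * |s| := by nlinarith [neg_abs_le s]
      _ ≤ b * |s| := by gcongr; exact hx.2
  gcongr ?_ * ?_ <;> apply Real.exp_le_exp.2
  · nlinarith [mul_le_mul_of_nonneg_left h1 hk.le]
  · have : k * a * T ^ 2 ≤ k * x * T ^ 2 := by gcongr; exact hx.1.le
    linarith

theorem integral_airyKernel_eq_of_le {k a b : ℝ} (hk : 0 < k) (ha : 0 < a) (hab : a ≤ b)
    (s : ℝ) :
    ∫ t : ℝ, airyKernel k s (a + t * I) = ∫ t : ℝ, airyKernel k s (b + t * I) := by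
  have hv (r : ℝ) (hr : 0 < r) := intervalIntegral_tendsto_integral
    (integrable_airyKernel hk hr s) tendsto_neg_atTop_atBot tendsto_id
  have hp := tendsto_integral_airyKernel_horizontal hk ha hab s 1 (by norm_num)
  have hm := tendsto_integral_airyKernel_horizontal hk ha hab s (-1) (by norm_num)
  have hlim := ((hm.sub hp).add ((hv b (ha.trans_le hab)).const_smul I)).sub
    ((hv a ha).const_smul I)
  have hzero (T : ℝ) := integral_boundary_rect_eq_zero_of_differentiableOn (airyKernel k s)
    ⟨a, -T⟩ ⟨b, T⟩ (by unfold airyKernel; fun_prop)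
  have := tendsto_nhds_unique (hlim.congr fun T => by simpa using hzero T) tendsto_const_nhds
  rw [sub_zero, zero_add, ← smul_sub, smul_eq_zero_iff_right I_ne_zero, sub_eq_zero] at this
  exact this.symm

theorem integral_airyKernel_eq {k a b : ℝ} (hk : 0 < k) (ha : 0 < a) (hb : 0 < b) (s : ℝ) :
    ∫ t : ℝ, airyKernel k s (a + t * I) = ∫ t : ℝ, airyKernel k s (b + t * I) := by
  rcases le_total a b with h | h
  · exact integral_airyKernel_eq_of_le hk ha h s
  · exact (integral_airyKernel_eq_of_le hk hb h s).symm

theorem dilatedAiry_eq {k r : ℝ} (hk : 0 < k) (hr : 0 < r) (s : ℝ) :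
    dilatedAiry k s = (1 / (2 * Real.pi)) * ∫ t : ℝ, airyKernel k s (r + t * I) := by
  rw [dilatedAiry, integral_airyKernel_eq hk one_pos hr]

theorem ofReal_Ai (x : ℝ) : (Ai x : ℂ) = dilatedAiry 1 x := by
  have hint := integrable_airyKernel one_pos one_pos x
  have hconj : (starRingEnd ℂ) (∫ t : ℝ, airyKernel 1 x ((1 : ℝ) + t * I)) =
      ∫ t : ℝ, airyKernel 1 x ((1 : ℝ) + t * I) := by
    rw [← integral_conj, ← integral_neg_eq_self]
    congr 1 with t
    simp [airyKernel, ← exp_conj, conj_ofNat]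
  have hre : (∫ t : ℝ, (airyKernel 1 x ((1 : ℝ) + t * I)).re) =
      (∫ t : ℝ, airyKernel 1 x ((1 : ℝ) + t * I)).re := reCLM.integral_comp_comm hint
  rw [dilatedAiry, ← conj_eq_iff_re.1 hconj, ← hre]
  simp [Ai, airyKernel]

theorem rpow_mul_Ai {k : ℝ} (hk : 0 < k) (s : ℝ) :
    ((k ^ (-(1 : ℝ) / 3) * Ai (k ^ (-(1 : ℝ) / 3) * s) : ℝ) : ℂ) = dilatedAiry k s := by
  set q : ℝ := k ^ (-(1 : ℝ) / 3) with hq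
  have hq0 : 0 < q := Real.rpow_pos_of_pos hk _
  have hkq : k * q ^ 3 = 1 := by
    rw [hq, ← Real.rpow_natCast, ← Real.rpow_mul hk.le]
    norm_num
    rw [Real.rpow_neg_one, mul_inv_cancel₀ hk.ne']
  have hkq' : (k : ℂ) * (q : ℂ) ^ 3 = 1 := by exact_mod_cast hkq
  have hsub := Measure.integral_comp_mul_left
    (fun t : ℝ => airyKernel k s (q + t * I)) q
  have hker (t : ℝ) : airyKernel k s (q + (q * t : ℝ) * I) =
      airyKernel 1 (q * s) ((1 : ℝ) + t * I) := by
    rw [airyKernel, airyKernel]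
    congr 1
    push_cast
    linear_combination ((1 + t * I) ^ 3 / 3 : ℂ) * hkq'
  simp only [hker] at hsub
  rw [ofReal_mul, ofReal_Ai, dilatedAiry, hsub, dilatedAiry_eq hk hq0,
    abs_of_pos (inv_pos.2 hq0), real_smul]
  have : (q : ℂ) ≠ 0 := by exact_mod_cast hq0.ne'
  generalize ∫ t : ℝ, airyKernel k s (q + t * I) = J
  push_cast
  field_simp

theorem exists_norm_dilatedAiry_le {k r : ℝ} (hk : 0 < k) (hr : 0 < r) :
    ∃ C : ℝ, ∀ s, ‖dilatedAiry k s‖ ≤ C * Real.exp (-(r * s)) := by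
  refine ⟨1 / (2 * Real.pi) * (Real.exp (k * r ^ 3 / 3) *
    ∫ t : ℝ, Real.exp (-(k * r) * t ^ 2)), fun s => ?_⟩
  rw [dilatedAiry_eq hk hr, norm_mul]
  have h1 : ‖(1 / (2 * Real.pi) : ℂ)‖ = 1 / (2 * Real.pi) := by
    simp [abs_of_pos Real.pi_pos]
  have h2 : ‖∫ t : ℝ, airyKernel k s (r + t * I)‖ ≤
      Real.exp (k * r ^ 3 / 3 - r * s) * ∫ t : ℝ, Real.exp (-(k * r) * t ^ 2) := by
    refine (norm_integral_le_integral_norm _).trans_eq ?_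
    simp only [norm_airyKernel, integral_const_mul]
  rw [h1]
  refine (mul_le_mul_of_nonneg_left h2 (by positivity)).trans_eq ?_
  rw [sub_eq_add_neg, Real.exp_add]
  ring

/-- The function on the frequency side whose Fourier transform is the exponentially weighted
dilated Airy function. -/
noncomputable def airyFrequency (k v : ℝ) : ℂ :=
  airyKernel k 0 ((1 : ℝ) + (2 * Real.pi * v : ℝ) * I)

theorem continuous_airyFrequency (k : ℝ) : Continuous (airyFrequency k) :=
  (continuous_airyKernel k 0).comp (by fun_prop)

theorem integrable_airyFrequency {k : ℝ} (hk : 0 < k) : Integrable (airyFrequency k) :=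
  (integrable_airyKernel hk one_pos 0).comp_mul_left' (R := 2 * Real.pi) (by positivity)

theorem airyFrequency_mul (k l v : ℝ) :
    airyFrequency k v * airyFrequency l v = airyFrequency (k + l) v := by
  simp only [airyFrequency, airyKernel, ← exp_add]
  congr 1
  push_cast
  ring

theorem fourier_airyFrequency (k s : ℝ) :
    𝓕 (airyFrequency k) s = exp s * dilatedAiry k s := by
  have hsub := Measure.integral_comp_mul_left
    (fun t : ℝ => airyKernel k s ((1 : ℝ) + t * I)) (2 * Real.pi)
  have hker (v : ℝ) : exp ((-2 * Real.pi * v * s : ℝ) * I) • airyFrequency k v =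
      exp s * airyKernel k s ((1 : ℝ) + (2 * Real.pi * v : ℝ) * I) := by
    simp only [airyFrequency, airyKernel, ← exp_add, smul_eq_mul]
    congr 1
    push_cast
    ring
  rw [Real.fourier_real_eq_integral_exp_smul, dilatedAiry]
  simp only [hker, integral_const_mul, hsub]
  rw [abs_of_pos (by positivity), real_smul]
  push_cast
  ring

theorem continuous_dilatedAiry {k : ℝ} (hk : 0 < k) : Continuous (dilatedAiry k) := by
  have hF : Continuous (𝓕 (airyFrequency k)) :=
    VectorFourier.fourierIntegral_continuous Real.continuous_fourierChar
      (innerSL ℝ).continuous₂ (integrable_airyFrequency hk)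
  have : dilatedAiry k = fun s : ℝ => exp (-s) * 𝓕 (airyFrequency k) s := by
    ext s
    rw [fourier_airyFrequency, ← mul_assoc, ← exp_add, neg_add_cancel, exp_zero, one_mul]
  rw [this]
  fun_prop

theorem integrable_exp_mul_dilatedAiry {k : ℝ} (hk : 0 < k) :
    Integrable (fun s : ℝ => exp s * dilatedAiry k s) := by
  have hcont := continuous_dilatedAiry hk
  have hmeas : Continuous (fun s : ℝ => exp s * dilatedAiry k s) := by fun_prop
  have hnorm (s : ℝ) : ‖exp s * dilatedAiry k s‖ = Real.exp s * ‖dilatedAiry k s‖ := by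
    rw [norm_mul, norm_exp_ofReal]
  obtain ⟨C, hC⟩ := exists_norm_dilatedAiry_le hk one_half_pos
  obtain ⟨D, hD⟩ := exists_norm_dilatedAiry_le hk two_pos
  rw [← integrableOn_univ, ← Set.Iic_union_Ioi (a := (0 : ℝ))]
  refine IntegrableOn.union ?_ ?_
  · refine ((integrableOn_exp_mul_Iic one_half_pos 0).const_mul C).mono'
      hmeas.aestronglyMeasurable (.of_forall fun s => ?_)
    rw [hnorm]
    refine (mul_le_mul_of_nonneg_left (hC s) (Real.exp_pos s).le).trans_eq ?_
    rw [mul_left_comm, ← Real.exp_add]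
    ring_nf
  · refine ((integrableOn_exp_mul_Ioi (neg_one_lt_zero (R := ℝ)) 0).const_mul D).mono'
      hmeas.aestronglyMeasurable (.of_forall fun s => ?_)
    rw [hnorm]
    refine (mul_le_mul_of_nonneg_left (hD s) (Real.exp_pos s).le).trans_eq ?_
    rw [mul_left_comm, ← Real.exp_add]
    ring_nf

theorem integral_fourier_mul_fourier_sub {f g : ℝ → ℂ} (hf : Integrable f) (hg : Integrable g)
    (hgc : Continuous g) (hFg : Integrable (𝓕 g)) (s : ℝ) :
    ∫ a, 𝓕 f a * 𝓕 g (s - a) = 𝓕 (fun v => f v * g v) s := by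
  have hflip : (∫ a, 𝓕 f a * 𝓕 g (s - a)) = ∫ v, f v * 𝓕 (fun a => 𝓕 g (s - a)) v := by
    have := VectorFourier.integral_fourierIntegral_smul_eq_flip (L := innerₗ ℝ)
      Real.continuous_fourierChar continuous_inner hf (hFg.comp_sub_left s)
    rwa [flip_innerₗ] at this
  have hinv (v : ℝ) : 𝓕 (fun a => 𝓕 g (s - a)) v =
      exp ((-2 * Real.pi * v * s : ℝ) * I) * g v := by
    rw [Real.fourier_real_eq_integral_exp_smul, ← integral_sub_left_eq_self _ volume s,
      ← hg.fourierInv_fourier_eq hFg hgc.continuousAt, Real.fourierInv_eq',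
      ← integral_const_mul]
    congr 1 with b
    simp only [sub_sub_cancel, smul_eq_mul, ← mul_assoc, ← exp_add]
    congr 2
    simp only [RCLike.inner_apply, conj_trivial]
    push_cast
    ring
  rw [hflip, Real.fourier_real_eq_integral_exp_smul]
  congr 1 with v
  rw [hinv, smul_eq_mul]
  ring

theorem integral_dilatedAiry_mul_dilatedAiry {k l : ℝ} (hk : 0 < k) (hl : 0 < l) (x y : ℝ) :
    ∫ z : ℝ, dilatedAiry k (x - z) * dilatedAiry l (z + y) = dilatedAiry (k + l) (x + y) := by
  have hconv := integral_fourier_mul_fourier_sub (integrable_airyFrequency hk)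
    (integrable_airyFrequency hl) (continuous_airyFrequency l)
    (by simpa only [funext (fourier_airyFrequency l)] using integrable_exp_mul_dilatedAiry hl)
    (x + y)
  simp only [airyFrequency_mul] at hconv
  rw [show (fun v => airyFrequency (k + l) v) = airyFrequency (k + l) from rfl,
    ← integral_sub_left_eq_self _ volume x] at hconv
  simp only [fourier_airyFrequency] at hconv
  have hexp (z : ℝ) : exp ((x - z : ℝ) : ℂ) * dilatedAiry k (x - z) *
      (exp ((x + y - (x - z) : ℝ) : ℂ) * dilatedAiry l (x + y - (x - z))) =
        exp ((x + y : ℝ) : ℂ) * (dilatedAiry k (x - z) * dilatedAiry l (z + y)) := by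
    rw [show x + y - (x - z) = z + y by ring, mul_mul_mul_comm, ← exp_add]
    congr 2
    push_cast
    ring
  simp only [hexp, integral_const_mul] at hconv
  exact mul_left_cancel₀ (exp_ne_zero _) hconv

theorem continuous_Ai : Continuous Ai := by
  have : Ai = fun x => (dilatedAiry 1 x).re := by ext x; rw [← ofReal_Ai, ofReal_re]
  rw [this]
  exact continuous_re.comp (continuous_dilatedAiry one_pos)

/-- The product of `f` over the consecutive differences of the chain `x, z₁, …, zₘ, y`. -/
noncomputable def chainProd (f : ℝ → ℝ) (m : ℕ) (x y : ℝ) (z : Fin m → ℝ) : ℝ :=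
  ∏ i : Fin (m + 1), f ((Fin.cons x (Fin.snoc z y) : Fin (m + 2) → ℝ) i.castSucc
    - (Fin.cons x (Fin.snoc z y) : Fin (m + 2) → ℝ) i.succ)

theorem chainProd_zero (f : ℝ → ℝ) (x y : ℝ) (z : Fin 0 → ℝ) :
    chainProd f 0 x y z = f (x - y) := by
  simp [chainProd, Fin.snoc]

theorem chainProd_cons (f : ℝ → ℝ) (m : ℕ) (x y a : ℝ) (z : Fin m → ℝ) :
    chainProd f (m + 1) x y (Fin.cons a z) = f (x - a) * chainProd f m a y z := by
  rw [chainProd, Fin.prod_univ_succ, ← Fin.cons_snoc_eq_snoc_cons]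
  simp [chainProd]

theorem continuous_chainProd {f : ℝ → ℝ} (hf : Continuous f) (m : ℕ) (y : ℝ) :
    Continuous (fun p : ℝ × (Fin m → ℝ) => chainProd f m p.1 y p.2) := by
  unfold chainProd
  fun_prop

theorem measurePreserving_cons (m : ℕ) :
    MeasurePreserving (MeasurableEquiv.piFinSuccAbove (fun _ : Fin (m + 1) => ℝ) 0).symm :=
  (volume_preserving_piFinSuccAbove (fun _ : Fin (m + 1) => ℝ) 0).symm

theorem chainProd_piFinSuccAbove_symm (f : ℝ → ℝ) (m : ℕ) (x y : ℝ) (p : ℝ × (Fin m → ℝ)) :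
    chainProd f (m + 1) x y
      ((MeasurableEquiv.piFinSuccAbove (fun _ : Fin (m + 1) => ℝ) 0).symm p) =
        f (x - p.1) * chainProd f m p.1 y p.2 := by
  rw [← chainProd_cons, ← Fin.insertNth_zero']
  rfl

open ENNReal in
theorem lintegral_chainProd_le {f : ℝ → ℝ} (hf : Continuous f) {C : ℝ≥0∞}
    (hC : ∀ s, ‖f s‖ₑ ≤ C * ENNReal.ofReal (Real.exp (-s))) (m : ℕ) (x y : ℝ) :
    ∫⁻ z, ‖chainProd f m x y z‖ₑ ≤
      C * (∫⁻ s, ‖Real.exp s * f s‖ₑ) ^ m * ENNReal.ofReal (Real.exp (-(x - y))) := by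
  induction m generalizing x with
  | zero => simpa [chainProd_zero, volume_pi] using hC (x - y)
  | succ m ih =>
    have hcont := continuous_chainProd hf m y
    rw [← (measurePreserving_cons m).lintegral_comp_emb (MeasurableEquiv.measurableEmbedding _)]
    set J := ∫⁻ s, ‖Real.exp s * f s‖ₑ with hJ
    simp only [chainProd_piFinSuccAbove_symm, enorm_mul]
    rw [Measure.volume_eq_prod, lintegral_prod _ (by fun_prop)]
    calc ∫⁻ a, ∫⁻ z, ‖f (x - a)‖ₑ * ‖chainProd f m a y z‖ₑ
        = ∫⁻ a, ‖f (x - a)‖ₑ * ∫⁻ z, ‖chainProd f m a y z‖ₑ := by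
          congr 1 with a
          have : Continuous (chainProd f m a y) :=
            hcont.comp (by fun_prop : Continuous fun z => (a, z))
          exact lintegral_const_mul _ (by fun_prop)
      _ ≤ ∫⁻ a, ‖f (x - a)‖ₑ * (C * J ^ m * ENNReal.ofReal (Real.exp (-(a - y)))) :=
          lintegral_mono fun a => by gcongr; exact ih a
      _ = ∫⁻ a, C * J ^ m * ENNReal.ofReal (Real.exp (-(x - y))) *
            ‖Real.exp (x - a) * f (x - a)‖ₑ := by
          congr 1 with a
          have : ENNReal.ofReal (Real.exp (-(a - y))) =
              ENNReal.ofReal (Real.exp (-(x - y))) * ‖Real.exp (x - a)‖ₑ := by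
            rw [Real.enorm_of_nonneg (Real.exp_pos _).le,
              ← ENNReal.ofReal_mul (Real.exp_pos _).le, ← Real.exp_add]
            ring_nf
          rw [this, enorm_mul]
          ring
      _ = C * J ^ (m + 1) * ENNReal.ofReal (Real.exp (-(x - y))) := by
          rw [lintegral_const_mul _ (by fun_prop),
            lintegral_sub_left_eq_self (fun s => ‖Real.exp s * f s‖ₑ), ← hJ]
          ring

theorem integrable_chainProd {f : ℝ → ℝ} (hf : Continuous f)
    (hint : Integrable fun s => Real.exp s * f s) {C : ℝ}
    (hC : ∀ s, |f s| ≤ C * Real.exp (-s)) (m : ℕ) (x y : ℝ) :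
    Integrable (chainProd f m x y) := by
  have hcont : Continuous (chainProd f m x y) :=
    (continuous_chainProd hf m y).comp (by fun_prop : Continuous fun z => (x, z))
  refine ⟨hcont.aestronglyMeasurable, (lintegral_chainProd_le hf
    (C := ENNReal.ofReal C) (fun s => ?_) m x y).trans_lt ?_⟩
  · rw [← ENNReal.ofReal_mul' (Real.exp_pos _).le, ← ofReal_norm]
    exact ENNReal.ofReal_le_ofReal (hC s)
  · exact ENNReal.mul_lt_top (ENNReal.mul_lt_top ENNReal.ofReal_lt_top
      (ENNReal.pow_lt_top hint.2)) ENNReal.ofReal_lt_top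

theorem integral_chainProd_succ {f : ℝ → ℝ} {m : ℕ} {x y : ℝ}
    (hint : Integrable (chainProd f (m + 1) x y)) :
    ∫ z, chainProd f (m + 1) x y z = ∫ a, f (x - a) * ∫ z, chainProd f m a y z := by
  have he := measurePreserving_cons m
  have hint' := (he.integrable_comp_emb (MeasurableEquiv.measurableEmbedding _)).2 hint
  rw [← he.integral_comp']
  simp only [Function.comp_def, chainProd_piFinSuccAbove_symm] at hint' ⊢
  rw [Measure.volume_eq_prod] at hint' ⊢
  rw [integral_prod _ hint']
  simp only [integral_const_mul]

theorem exists_abs_Ai_add_le (c : ℝ) : ∃ C : ℝ, ∀ s, |Ai (s + 2 * c)| ≤ C * Real.exp (-s) := by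
  obtain ⟨C, hC⟩ := exists_norm_dilatedAiry_le one_pos one_pos
  refine ⟨C * Real.exp (-(2 * c)), fun s => ?_⟩
  have h := hC (s + 2 * c)
  rw [← ofReal_Ai, norm_real, Real.norm_eq_abs] at h
  refine h.trans_eq ?_
  rw [mul_assoc, ← Real.exp_add]
  ring_nf

theorem integrable_exp_mul_Ai_add (c : ℝ) :
    Integrable (fun s => Real.exp s * Ai (s + 2 * c)) := by
  have h : Integrable (fun s => Real.exp s * Ai s) := by
    refine (integrable_exp_mul_dilatedAiry one_pos).re.congr (.of_forall fun s => ?_)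
    simp only [← ofReal_Ai, ← ofReal_exp, ← ofReal_mul]
    rfl
  refine ((h.comp_add_right (2 * c)).const_mul (Real.exp (-(2 * c)))).congr
    (.of_forall fun s => ?_)
  simp only [← mul_assoc, ← Real.exp_add]
  ring_nf

theorem integrable_chainProd_Ai (m : ℕ) (c x y : ℝ) :
    Integrable (chainProd (fun s => Ai (s + 2 * c)) m x y) := by
  have hAi := continuous_Ai
  obtain ⟨C, hC⟩ := exists_abs_Ai_add_le c
  exact integrable_chainProd (by fun_prop) (integrable_exp_mul_Ai_add c) hC m x y

theorem integral_chainProd_Ai (m : ℕ) (c x y : ℝ) :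
    ((∫ z, chainProd (fun s => Ai (s + 2 * c)) m x y z : ℝ) : ℂ) =
      dilatedAiry (m + 1) (x - y + 2 * (m + 1) * c) := by
  induction m generalizing x with
  | zero => simp [chainProd_zero, ofReal_Ai, volume_pi, measureReal_def]
  | succ m ih =>
    rw [integral_chainProd_succ (integrable_chainProd_Ai (m + 1) c x y), ← integral_complex_ofReal]
    have hconv := integral_dilatedAiry_mul_dilatedAiry one_pos
      (by positivity : (0 : ℝ) < m + 1) (x + 2 * c) (-y + 2 * (m + 1) * c)
    simp only [ofReal_mul, ofReal_Ai, ih]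
    refine (integral_congr_ae (.of_forall fun z => ?_)).trans (hconv.trans ?_)
    · congr 2 <;> ring
    · push_cast
      congr 1 <;> ring

/-- For `n = m + 1 ≥ 1`: the convolution identity
`∫_{ℝ^{n-1}} Ai(x - z₁ + 2c)···Ai(z_{n-2} - z_{n-1} + 2c)·Ai(z_{n-1} + y + 2c) dz
  = n^{-1/3} Ai(n^{-1/3}(x + y + 2nc))`, the integral being absolutely convergent.
The chain `x, z₁, …, z_{n-1}, -y` is encoded as `Fin.cons x (Fin.snoc z (-y))`, so that
the last factor is `Ai(z_{n-1} - (-y) + 2c) = Ai(z_{n-1} + y + 2c)`. -/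
theorem airy_convolution_mixed (m : ℕ) (c x y : ℝ) :
    Integrable (fun z : Fin m → ℝ =>
      ∏ i : Fin (m + 1),
        Ai ((Fin.cons x (Fin.snoc z (-y)) : Fin (m + 2) → ℝ) i.castSucc
          - (Fin.cons x (Fin.snoc z (-y)) : Fin (m + 2) → ℝ) i.succ + 2 * c)) ∧
    (∫ z : Fin m → ℝ,
        ∏ i : Fin (m + 1),
          Ai ((Fin.cons x (Fin.snoc z (-y)) : Fin (m + 2) → ℝ) i.castSucc
            - (Fin.cons x (Fin.snoc z (-y)) : Fin (m + 2) → ℝ) i.succ + 2 * c))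
      = ((m : ℝ) + 1) ^ (-(1 : ℝ) / 3) *
          Ai (((m : ℝ) + 1) ^ (-(1 : ℝ) / 3) * (x + y + 2 * ((m : ℝ) + 1) * c)) := by
  have hchain : (fun z : Fin m → ℝ => ∏ i : Fin (m + 1),
      Ai ((Fin.cons x (Fin.snoc z (-y)) : Fin (m + 2) → ℝ) i.castSucc
        - (Fin.cons x (Fin.snoc z (-y)) : Fin (m + 2) → ℝ) i.succ + 2 * c)) =
      chainProd (fun s => Ai (s + 2 * c)) m x (-y) := rfl
  rw [hchain]
  refine ⟨integrable_chainProd_Ai m c x (-y), ?_⟩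
  apply ofReal_injective
  rw [integral_chainProd_Ai, rpow_mul_Ai (by positivity), sub_neg_eq_add]
end
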